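/- Let n ≥ 1 and let X ∈ M(n,ℍ) be a quaternionic matrix with tr(Φ(X)) = 0. Then X is Ad_{SL(n,ℍ)}-real if and only if for every λ ∈ ℂ with nonzero real part and every natural number k, the ℂ-dimension of the kernel of (Φ(X) − λ·1)^k equals the ℂ-dimension of the kernel of (Φ(X) + λ·1)^k. (The latter condition says precisely that whenever an eigenvalue class of X has a representative λ with nonzero real part, −λ also represents an eigenvalue class of X with the same multiplicity and the same Jordan partition.) -/

import Mathlib

/-- The embedding Φ : M(n,ℍ) → M(2n,ℂ), written as a block matrix. -/
noncomputable def Phi {m : Type*} [Fintype m] [DecidableEq m]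
    (A : Matrix m m (Quaternion ℝ)) : Matrix (m ⊕ m) (m ⊕ m) ℂ :=
  Matrix.fromBlocks
    (Matrix.of fun k l => (⟨(A k l).re, (A k l).imI⟩ : ℂ))
    (Matrix.of fun k l => (⟨(A k l).imJ, (A k l).imK⟩ : ℂ))
    (-(Matrix.of fun k l => (starRingEnd ℂ) (⟨(A k l).imJ, (A k l).imK⟩ : ℂ)))
    (Matrix.of fun k l => (starRingEnd ℂ) (⟨(A k l).re, (A k l).imI⟩ : ℂ))

/-- The ℂ-dimension of the kernel of (the linear map associated to) a complex matrix. -/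
noncomputable def kerDim {m : Type*} [Fintype m] (Y : Matrix m m ℂ) : ℕ :=
  Module.finrank ℂ (LinearMap.ker Y.mulVecLin)

theorem sum_min_add_sum_min_add_card {α σ : Type*} [Fintype σ] [DecidableEq α]
    (s : σ → α × ℕ) (x : α × ℕ) :
      (∑ i, if (s i).1 = x.1 then min x.2 ((s i).2 + 1) else 0) +
      (∑ i, if (s i).1 = x.1 then min (x.2 + 2) ((s i).2 + 1) else 0) +
      Fintype.card {i // s i = x} =
    2 * ∑ i, if (s i).1 = x.1 then min (x.2 + 1) ((s i).2 + 1) else 0 := by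
  rw [Fintype.card_subtype, Finset.card_filter, ← Finset.sum_add_distrib,
    ← Finset.sum_add_distrib, Finset.mul_sum]
  refine Finset.sum_congr rfl fun i _ => ?_
  simp only [Prod.ext_iff]
  split_ifs <;> grind

/-- The truncated sums of block sizes determine the number of blocks of each size. -/
theorem card_fiber_eq_of_sum_min_eq {α ι κ : Type*} [Fintype ι] [Fintype κ] [DecidableEq α]
    (c : ι → α × ℕ) (d : κ → α × ℕ)
    (h : ∀ a k, (∑ i, if (c i).1 = a then min k ((c i).2 + 1) else 0) =
      ∑ j, if (d j).1 = a then min k ((d j).2 + 1) else 0) (x : α × ℕ) :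
    Fintype.card {i // c i = x} = Fintype.card {j // d j = x} := by
  have h1 := sum_min_add_sum_min_add_card c x
  have h2 := sum_min_add_sum_min_add_card d x
  rw [h, h, h] at h1
  omega

section
open Polynomial
universe u
variable {K : Type u} [Field K]

theorem finrank_torsionBy_quotient_pow (a b : K) (k e : ℕ) [Decidable (b = a)] :
    Module.finrank K (Submodule.torsionBy K[X]
      (K[X] ⧸ Ideal.span {(X - C b) ^ e}) ((X - C a) ^ k)) =
      if b = a then min k e else 0 := by
  have hdim (c : K) (m : ℕ) :
      Module.finrank K (K[X] ⧸ Ideal.span {(X - C c) ^ m}) = m := by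
    rw [finrank_quotient_span_eq_natDegree, natDegree_pow, natDegree_X_sub_C, mul_one]
  split_ifs with h
  · subst h
    rcases le_total e k with hek | hke
    · have htop : Submodule.torsionBy K[X] (K[X] ⧸ Ideal.span {(X - C b) ^ e})
          ((X - C b) ^ k) = ⊤ := by
        refine eq_top_iff.2 fun x _ => ?_
        obtain ⟨x, rfl⟩ := Ideal.Quotient.mk_surjective x
        rw [Submodule.mem_torsionBy_iff, ← Ideal.Quotient.mk_eq_mk, ← Submodule.Quotient.mk_smul,
          Submodule.Quotient.mk_eq_zero, Ideal.mem_span_singleton, smul_eq_mul]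
        exact (pow_dvd_pow _ hek).mul_right _
      have e1 := ((LinearEquiv.ofTop _ htop).restrictScalars K).finrank_eq
      rw [min_eq_right hek]
      exact e1.trans (hdim b e)
    · obtain ⟨d, rfl⟩ := Nat.exists_eq_add_of_le hke
      let f := LinearMap.toSpanSingleton K[X] (K[X] ⧸ Ideal.span {(X - C b) ^ (k + d)})
        (Ideal.Quotient.mk _ ((X - C b) ^ d))
      have hne (m : ℕ) : (X - C b) ^ m ≠ 0 := pow_ne_zero _ (X_sub_C_ne_zero b)
      have hker : LinearMap.ker f = Ideal.span {(X - C b) ^ k} := by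
        ext x
        rw [LinearMap.mem_ker, LinearMap.toSpanSingleton_apply, ← Ideal.Quotient.mk_eq_mk,
          ← Submodule.Quotient.mk_smul, Submodule.Quotient.mk_eq_zero, Ideal.mem_span_singleton,
          Ideal.mem_span_singleton, smul_eq_mul, pow_add]
        exact mul_dvd_mul_iff_right (hne d)
      have hrange : LinearMap.range f = Submodule.torsionBy K[X]
          (K[X] ⧸ Ideal.span {(X - C b) ^ (k + d)}) ((X - C b) ^ k) := by
        ext x
        obtain ⟨x, rfl⟩ := Ideal.Quotient.mk_surjective x
        rw [Submodule.mem_torsionBy_iff, ← Ideal.Quotient.mk_eq_mk, ← Submodule.Quotient.mk_smul,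
          Submodule.Quotient.mk_eq_zero, Ideal.mem_span_singleton, smul_eq_mul, LinearMap.mem_range]
        have hdvd : (X - C b) ^ (k + d) ∣ (X - C b) ^ k * x ↔ (X - C b) ^ d ∣ x := by
          rw [pow_add, mul_dvd_mul_iff_left (hne k)]
        rw [hdvd]
        constructor
        · rintro ⟨y, hy⟩
          rw [LinearMap.toSpanSingleton_apply, ← Ideal.Quotient.mk_eq_mk,
            ← Submodule.Quotient.mk_smul, Submodule.Quotient.eq, Ideal.mem_span_singleton,
            smul_eq_mul] at hy
          have := ((pow_dvd_pow (X - C b) (Nat.le_add_left d k)).trans hy)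
          exact (dvd_sub_right (dvd_mul_left _ _)).1 this
        · rintro ⟨y, rfl⟩
          exact ⟨y, by rw [LinearMap.toSpanSingleton_apply, ← Ideal.Quotient.mk_eq_mk,
            ← Submodule.Quotient.mk_smul, smul_eq_mul, mul_comm]⟩
      have e1 := (((Submodule.quotEquivOfEq _ _ hker).symm.trans
        (f.quotKerEquivRange.trans (LinearEquiv.ofEq _ _ hrange))).restrictScalars K).finrank_eq
      rw [min_eq_left hke]
      exact e1.symm.trans (hdim b k)
  · have hbot : Submodule.torsionBy K[X] (K[X] ⧸ Ideal.span {(X - C b) ^ e})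
        ((X - C a) ^ k) = ⊥ := by
      refine (Submodule.eq_bot_iff _).2 fun x hx => ?_
      obtain ⟨x, rfl⟩ := Ideal.Quotient.mk_surjective x
      rw [Submodule.mem_torsionBy_iff, ← Ideal.Quotient.mk_eq_mk, ← Submodule.Quotient.mk_smul,
        Submodule.Quotient.mk_eq_zero, Ideal.mem_span_singleton, smul_eq_mul] at hx
      rw [← Ideal.Quotient.mk_eq_mk, Submodule.Quotient.mk_eq_zero, Ideal.mem_span_singleton]
      exact ((isCoprime_X_sub_C_of_isUnit_sub (sub_ne_zero.2 h).isUnit).pow).dvd_of_dvd_mul_left hx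
    have e1 := ((LinearEquiv.ofEq _ _ hbot).restrictScalars K).finrank_eq
    refine e1.trans ?_
    exact Module.finrank_zero_of_subsingleton (M := (⊥ : Submodule K[X] (K[X] ⧸ Ideal.span {(X - C b) ^ e})))

variable {V W : Type*} [AddCommGroup V] [Module K V] [AddCommGroup W] [Module K W]

/-- Jordan decomposition: over an algebraically closed field, the `K[X]`-module attached to an
endomorphism is a finite product of modules `K[X] / (X - a) ^ (e + 1)`. -/
theorem exists_linearEquiv_pi_quotient_pow [IsAlgClosed K] [FiniteDimensional K V]
    (φ : Module.End K V) :
    ∃ (ι : Type u) (_ : Fintype ι) (c : ι → K × ℕ),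
      Nonempty (Module.AEval' φ ≃ₗ[K[X]]
        ∀ i, K[X] ⧸ Ideal.span {(X - C (c i).1) ^ ((c i).2 + 1)}) := by
  classical
  have htors : Module.IsTorsion K[X] (Module.AEval' φ) :=
    Module.AEval.isTorsion_of_finiteDimensional K V φ
  obtain ⟨ι, _, p, hp, e, ⟨f⟩⟩ := Module.equiv_directSum_of_isTorsion htors
  have hroot (i : ι) : ∃ a, Associated (p i) (X - C a) := by
    obtain ⟨a, ha⟩ := IsAlgClosed.exists_root (p i)
      (by rw [IsAlgClosed.degree_eq_one_of_irreducible K (hp i)]; exact one_ne_zero)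
    exact ⟨a, ((irreducible_X_sub_C a).associated_of_dvd (hp i) (dvd_iff_isRoot.2 ha)).symm⟩
  choose a ha using hroot
  have hspan (i : ι) : Submodule.span K[X] {p i ^ e i} = Ideal.span {(X - C (a i)) ^ e i} :=
    Ideal.span_singleton_eq_span_singleton.2 ((ha i).pow_pow)
  let g := (f.trans (DirectSum.linearEquivFunOnFintype K[X] ι _)).trans
    (LinearEquiv.piCongrRight fun i => Submodule.quotEquivOfEq _ _ (hspan i))
  let r : (∀ i, K[X] ⧸ Ideal.span {(X - C (a i)) ^ e i}) →ₗ[K[X]]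
      ∀ i : {i // e i ≠ 0}, K[X] ⧸ Ideal.span {(X - C (a i)) ^ e i} :=
    LinearMap.pi fun i => LinearMap.proj i.1
  have hr : Function.Bijective r := by
    constructor
    · intro x y hxy
      funext i
      by_cases hi : e i = 0
      · have : Subsingleton (K[X] ⧸ Ideal.span {(X - C (a i)) ^ e i}) := by
          rw [hi, pow_zero, Ideal.span_singleton_one]; infer_instance
        exact Subsingleton.elim _ _
      · exact congrFun hxy ⟨i, hi⟩
    · intro y
      refine ⟨fun i => if h : e i ≠ 0 then y ⟨i, h⟩ else 0, ?_⟩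
      funext i
      exact dif_pos i.2
  refine ⟨{i // e i ≠ 0}, inferInstance, fun i => (a i, e i - 1),
    ⟨(g.trans (LinearEquiv.ofBijective r hr)).trans (LinearEquiv.piCongrRight fun i =>
      Submodule.quotEquivOfEq _ _ ?_)⟩⟩
  rw [Nat.sub_add_cancel (Nat.one_le_iff_ne_zero.2 i.2)]

/-- The dimension of `ker (φ - a) ^ k` in terms of the Jordan blocks of `φ`. -/
theorem finrank_ker_pow_of_linearEquiv_pi {ι : Type*} [Fintype ι] [DecidableEq K]
    {φ : Module.End K V}
    {c : ι → K × ℕ} (f : Module.AEval' φ ≃ₗ[K[X]]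
        ∀ i, K[X] ⧸ Ideal.span {(X - C (c i).1) ^ ((c i).2 + 1)}) (a : K) (k : ℕ) :
    Module.finrank K (LinearMap.ker ((φ - algebraMap K _ a) ^ k)) =
      ∑ i, if (c i).1 = a then min k ((c i).2 + 1) else 0 := by
  have hmem (x : V) : x ∈ LinearMap.ker ((φ - algebraMap K _ a) ^ k) ↔
      ∀ i, f (Module.AEval'.of φ x) i ∈ Submodule.torsionBy K[X]
      (K[X] ⧸ Ideal.span {(X - C (c i).1) ^ ((c i).2 + 1)}) ((X - C a) ^ k) := by
    have h1 : (X - C a) ^ k • Module.AEval'.of φ x =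
        Module.AEval'.of φ (((φ - algebraMap K _ a) ^ k) x) := by
      have := Module.AEval.of_aeval_smul (a := φ) ((X - C a) ^ k) x
      rw [← this]
      simp
    have h2 : (∀ i, f (Module.AEval'.of φ x) i ∈ Submodule.torsionBy K[X]
        (K[X] ⧸ Ideal.span {(X - C (c i).1) ^ ((c i).2 + 1)}) ((X - C a) ^ k)) ↔
        (X - C a) ^ k • f (Module.AEval'.of φ x) = 0 := by
      rw [funext_iff]
      exact Iff.rfl
    rw [h2, ← map_smul, h1, LinearMap.mem_ker, LinearEquiv.map_eq_zero_iff,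
      LinearEquiv.map_eq_zero_iff]
  let F : LinearMap.ker ((φ - algebraMap K _ a) ^ k) →ₗ[K] ∀ i, Submodule.torsionBy K[X]
      (K[X] ⧸ Ideal.span {(X - C (c i).1) ^ ((c i).2 + 1)}) ((X - C a) ^ k) :=
    { toFun := fun x i => ⟨f (Module.AEval'.of φ x) i, (hmem x).1 x.2 i⟩
      map_add' := fun x y => by ext i; simp
      map_smul' := fun t x => by
        ext i
        simp only [Submodule.coe_smul, map_smul, RingHom.id_apply, Pi.smul_apply]
        rw [← algebraMap_smul K[X] t, map_smul, Pi.smul_apply, algebraMap_smul]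
        rfl }
  have hF : Function.Bijective F := by
    constructor
    · intro x y hxy
      have : f (Module.AEval'.of φ x) = f (Module.AEval'.of φ y) := by
        funext i
        exact congrArg Subtype.val (congrFun hxy i)
      exact Subtype.ext ((Module.AEval'.of φ).injective (f.injective this))
    · intro y
      refine ⟨⟨(Module.AEval'.of φ).symm (f.symm fun i => y i), (hmem _).2 fun i => ?_⟩, ?_⟩
      · simp
      · funext i
        apply Subtype.ext
        simp [F]
  have hfin (i : ι) : Module.Finite K (Submodule.torsionBy K[X]
      (K[X] ⧸ Ideal.span {(X - C (c i).1) ^ ((c i).2 + 1)}) ((X - C a) ^ k)) := by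
    have : Module.Finite K (K[X] ⧸ Ideal.span {(X - C (c i).1) ^ ((c i).2 + 1)}) :=
      ((monic_X_sub_C _).pow _).finite_quotient
    exact inferInstanceAs (Module.Finite K ((Submodule.torsionBy K[X]
      (K[X] ⧸ Ideal.span {(X - C (c i).1) ^ ((c i).2 + 1)}) ((X - C a) ^ k)).restrictScalars K))
  have hfree (i : ι) : Module.Free K (Submodule.torsionBy K[X]
      (K[X] ⧸ Ideal.span {(X - C (c i).1) ^ ((c i).2 + 1)}) ((X - C a) ^ k)) :=
    inferInstanceAs (Module.Free K ((Submodule.torsionBy K[X]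
      (K[X] ⧸ Ideal.span {(X - C (c i).1) ^ ((c i).2 + 1)}) ((X - C a) ^ k)).restrictScalars K))
  rw [(LinearEquiv.ofBijective F hF).finrank_eq, Module.finrank_pi_fintype]
  exact Finset.sum_congr rfl fun i _ => finrank_torsionBy_quotient_pow _ _ _ _

/-- Over an algebraically closed field, two endomorphisms with the same generalized eigenspace
dimensions are conjugate. -/
theorem exists_linearEquiv_comp_eq_of_finrank_ker_eq [IsAlgClosed K]
    [FiniteDimensional K V] [FiniteDimensional K W]
    (φ : Module.End K V) (ψ : Module.End K W)
    (h : ∀ (a : K) (k : ℕ), Module.finrank K (LinearMap.ker ((φ - algebraMap K _ a) ^ k)) =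
      Module.finrank K (LinearMap.ker ((ψ - algebraMap K _ a) ^ k))) :
    ∃ e : V ≃ₗ[K] W, ∀ x, e (φ x) = ψ (e x) := by
  classical
  obtain ⟨ι, _, c, ⟨f⟩⟩ := exists_linearEquiv_pi_quotient_pow φ
  obtain ⟨κ, _, d, ⟨g⟩⟩ := exists_linearEquiv_pi_quotient_pow ψ
  have hcard := card_fiber_eq_of_sum_min_eq c d fun a k => by
    rw [← finrank_ker_pow_of_linearEquiv_pi f, ← finrank_ker_pow_of_linearEquiv_pi g, h]
  let σ : ι ≃ κ := Equiv.ofFiberEquiv fun x => Fintype.equivOfCardEq (hcard x)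
  have hσ (i : ι) : d (σ i) = c i := Equiv.ofFiberEquiv_map _ i
  let E : Module.AEval' φ ≃ₗ[K[X]] Module.AEval' ψ :=
    (f.trans ((LinearEquiv.piCongrRight fun i => Submodule.quotEquivOfEq _ _
      (by rw [hσ])).trans (LinearEquiv.piCongrLeft K[X]
        (fun j => K[X] ⧸ Ideal.span {(X - C (d j).1) ^ ((d j).2 + 1)}) σ))).trans g.symm
  refine ⟨(Module.AEval'.of φ).trans ((E.restrictScalars K).trans (Module.AEval'.of ψ).symm),
    fun x => ?_⟩
  simp only [LinearEquiv.trans_apply, LinearEquiv.restrictScalars_apply]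
  rw [← Module.AEval'.X_smul_of, map_smul, Module.AEval'.of_symm_X_smul]
end

section
open Matrix ComplexConjugate
open scoped ComplexOrder

variable {m n p : Type*}

/-- The complex number `z` in the decomposition `q = z + w * j`. -/
def Quaternion.complexFst : Quaternion ℝ →+ ℂ where
  toFun q := ⟨q.re, q.imI⟩
  map_zero' := rfl
  map_add' _ _ := rfl

/-- The complex number `w` in the decomposition `q = z + w * j`. -/
def Quaternion.complexSnd : Quaternion ℝ →+ ℂ where
  toFun q := ⟨q.imJ, q.imK⟩
  map_zero' := rfl
  map_add' _ _ := rfl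

@[simp] theorem Quaternion.complexFst_re (q : Quaternion ℝ) : (complexFst q).re = q.re := rfl
@[simp] theorem Quaternion.complexFst_im (q : Quaternion ℝ) : (complexFst q).im = q.imI := rfl
@[simp] theorem Quaternion.complexSnd_re (q : Quaternion ℝ) : (complexSnd q).re = q.imJ := rfl
@[simp] theorem Quaternion.complexSnd_im (q : Quaternion ℝ) : (complexSnd q).im = q.imK := rfl

theorem Quaternion.complexFst_mul (a b : Quaternion ℝ) :
    complexFst (a * b) = complexFst a * complexFst b - complexSnd a * conj (complexSnd b) := by
  apply Complex.ext <;> simp <;> ring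

theorem Quaternion.complexSnd_mul (a b : Quaternion ℝ) :
    complexSnd (a * b) = complexFst a * complexSnd b + complexSnd a * conj (complexFst b) := by
  apply Complex.ext <;> simp <;> ring

/-- The complex block matrix of a rectangular quaternionic matrix, extending `Phi`. -/
def quaternionBlocks (A : Matrix m n (Quaternion ℝ)) : Matrix (m ⊕ m) (n ⊕ n) ℂ :=
  fromBlocks (A.map Quaternion.complexFst) (A.map Quaternion.complexSnd)
    (-(A.map fun q => conj (Quaternion.complexSnd q))) (A.map fun q => conj (Quaternion.complexFst q))

theorem Phi_eq_quaternionBlocks [Fintype m] [DecidableEq m] (A : Matrix m m (Quaternion ℝ)) :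
    Phi A = quaternionBlocks A := rfl

theorem quaternionBlocks_mul [Fintype n] (A : Matrix m n (Quaternion ℝ))
    (B : Matrix n p (Quaternion ℝ)) :
    quaternionBlocks (A * B) = quaternionBlocks A * quaternionBlocks B := by
  rw [quaternionBlocks, quaternionBlocks, quaternionBlocks, fromBlocks_multiply]
  congr 1 <;> ext i j <;>
    simp only [map_apply, mul_apply, Matrix.add_apply, Matrix.neg_apply, map_sum, Quaternion.complexFst_mul,
      Quaternion.complexSnd_mul, ← Finset.sum_add_distrib, ← Finset.sum_neg_distrib] <;>
    refine Finset.sum_congr rfl fun k _ => ?_ <;> simp <;> ring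

theorem quaternionBlocks_add (A B : Matrix m n (Quaternion ℝ)) :
    quaternionBlocks (A + B) = quaternionBlocks A + quaternionBlocks B := by
  rw [quaternionBlocks, quaternionBlocks, quaternionBlocks, fromBlocks_add]
  congr 1 <;> ext i j <;> simp
  ring

theorem quaternionBlocks_neg (A : Matrix m n (Quaternion ℝ)) :
    quaternionBlocks (-A) = -quaternionBlocks A := by
  rw [quaternionBlocks, quaternionBlocks, fromBlocks_neg]
  congr 1

theorem quaternionBlocks_sub (A B : Matrix m n (Quaternion ℝ)) :
    quaternionBlocks (A - B) = quaternionBlocks A - quaternionBlocks B := by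
  rw [sub_eq_add_neg, quaternionBlocks_add, quaternionBlocks_neg, sub_eq_add_neg]

theorem quaternionBlocks_smul (t : ℝ) (A : Matrix m n (Quaternion ℝ)) :
    quaternionBlocks (t • A) = (t : ℂ) • quaternionBlocks A := by
  rw [quaternionBlocks, quaternionBlocks, fromBlocks_smul]
  congr 1 <;> ext i j <;>
    apply Complex.ext <;> simp

theorem quaternionBlocks_one [DecidableEq m] :
    quaternionBlocks (1 : Matrix m m (Quaternion ℝ)) = 1 := by
  rw [quaternionBlocks, ← fromBlocks_one]
  congr 1 <;> ext i j <;> by_cases h : i = j <;>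
    apply Complex.ext <;> simp [h, one_apply] <;> rfl

theorem quaternionBlocks_injective :
    Function.Injective (quaternionBlocks : Matrix m n (Quaternion ℝ) → _) := by
  intro A B h
  obtain ⟨h1, h2, -, -⟩ := fromBlocks_inj.1 h
  ext i j
  · exact congrArg Complex.re (congrFun (congrFun h1 i) j)
  · exact congrArg Complex.im (congrFun (congrFun h1 i) j)
  · exact congrArg Complex.re (congrFun (congrFun h2 i) j)
  · exact congrArg Complex.im (congrFun (congrFun h2 i) j)

/-- The matrix of right multiplication by `j`; it characterizes the image of
`quaternionBlocks`, see `exists_quaternionBlocks_eq`. -/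
def quaternionJ (m : Type*) [DecidableEq m] : Matrix (m ⊕ m) (m ⊕ m) ℂ := fromBlocks 0 1 (-1) 0

variable [Fintype m] [DecidableEq m]

theorem quaternionJ_mul_self : quaternionJ m * quaternionJ m = -1 := by
  rw [quaternionJ, fromBlocks_multiply, ← fromBlocks_one, fromBlocks_neg]
  simp

theorem isUnit_quaternionJ : IsUnit (quaternionJ m) :=
  IsUnit.of_mul_eq_one (-quaternionJ m) (by rw [mul_neg, quaternionJ_mul_self, neg_neg])

theorem quaternionJ_mul_conj (A : Matrix m m (Quaternion ℝ)) :
    quaternionJ m * (starRingEnd ℂ).mapMatrix (quaternionBlocks A) =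
      quaternionBlocks A * quaternionJ m := by
  rw [RingHom.mapMatrix_apply, quaternionBlocks, fromBlocks_map, quaternionJ, fromBlocks_multiply,
    fromBlocks_multiply]
  congr 1 <;> ext i j <;> simp

theorem exists_quaternionBlocks_eq {P : Matrix (m ⊕ m) (m ⊕ m) ℂ}
    (h : quaternionJ m * (starRingEnd ℂ).mapMatrix P = P * quaternionJ m) :
    ∃ A : Matrix m m (Quaternion ℝ), quaternionBlocks A = P := by
  rw [← fromBlocks_toBlocks P, RingHom.mapMatrix_apply, fromBlocks_map, quaternionJ,
    fromBlocks_multiply, fromBlocks_multiply] at h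
  obtain ⟨-, -, h3, h4⟩ := fromBlocks_inj.1 h
  refine ⟨of fun i j => ⟨(P.toBlocks₁₁ i j).re, (P.toBlocks₁₁ i j).im, (P.toBlocks₁₂ i j).re,
    (P.toBlocks₁₂ i j).im⟩, ?_⟩
  rw [← fromBlocks_toBlocks P, quaternionBlocks]
  congr 1
  · ext i j
    have : -conj (P.toBlocks₁₂ i j) = P.toBlocks₂₁ i j := by simpa using congrFun (congrFun h4 i) j
    exact this
  · ext i j
    have : conj (P.toBlocks₁₁ i j) = P.toBlocks₂₂ i j := by simpa using congrFun (congrFun h3 i) j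
    exact this

theorem kerDim_add_rank {n : Type*} [Fintype n] (Y : Matrix n n ℂ) :
    kerDim Y + Y.rank = Fintype.card n := by
  rw [kerDim, Matrix.rank, add_comm, LinearMap.finrank_range_add_finrank_ker,
    Module.finrank_fintype_fun_eq_card]

theorem kerDim_eq_of_rank_eq {n : Type*} [Fintype n] {Y Z : Matrix n n ℂ} (h : Y.rank = Z.rank) :
    kerDim Y = kerDim Z := by
  have h1 := kerDim_add_rank Y
  have h2 := kerDim_add_rank Z
  omega

theorem kerDim_eq_of_mul_eq_mul {P Y Z : Matrix m m ℂ} (hP : IsUnit P) (h : P * Y = Z * P) :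
    kerDim Y = kerDim Z := by
  have hdet := (isUnit_iff_isUnit_det P).1 hP
  apply kerDim_eq_of_rank_eq
  rw [← rank_mul_eq_right_of_isUnit_det P Y hdet, h, rank_mul_eq_left_of_isUnit_det P Z hdet]

theorem kerDim_neg_pow (Y : Matrix m m ℂ) (k : ℕ) : kerDim ((-Y) ^ k) = kerDim (Y ^ k) := by
  rw [neg_pow]
  apply kerDim_eq_of_rank_eq
  exact rank_mul_eq_right_of_isUnit_det _ _
    ((isUnit_iff_isUnit_det _).1 (isUnit_one.neg.pow k))

theorem kerDim_conj (Y : Matrix m m ℂ) : kerDim ((starRingEnd ℂ).mapMatrix Y) = kerDim Y := by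
  apply kerDim_eq_of_rank_eq
  rw [← rank_transpose, ← rank_conjTranspose Y]
  rfl

theorem kerDim_sub_conj (A : Matrix m m (Quaternion ℝ)) (a : ℂ) (k : ℕ) :
    kerDim ((quaternionBlocks A - conj a • 1) ^ k) = kerDim ((quaternionBlocks A - a • 1) ^ k) := by
  rw [← kerDim_conj ((quaternionBlocks A - a • 1) ^ k), map_pow]
  symm
  refine kerDim_eq_of_mul_eq_mul isUnit_quaternionJ (SemiconjBy.pow_right ?_ k)
  have hone : (starRingEnd ℂ).mapMatrix (a • (1 : Matrix (m ⊕ m) (m ⊕ m) ℂ)) = conj a • 1 := by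
    ext i j
    by_cases h : i = j <;> simp [one_apply, h]
  rw [SemiconjBy, map_sub, mul_sub, sub_mul, quaternionJ_mul_conj, hone]
  simp

theorem exists_isUnit_mul_eq_mul_of_kerDim_eq {A B : Matrix m m ℂ}
    (h : ∀ (a : ℂ) (k : ℕ), kerDim ((A - a • 1) ^ k) = kerDim ((B - a • 1) ^ k)) :
    ∃ P : Matrix m m ℂ, IsUnit P ∧ P * A = B * P := by
  have hpow (Y : Matrix m m ℂ) (a : ℂ) (k : ℕ) :
      (toLin' Y - algebraMap ℂ (Module.End ℂ (m → ℂ)) a) ^ k = toLin' ((Y - a • 1) ^ k) := by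
    rw [toLin'_pow, map_sub, map_smul, toLin'_one]
    rfl
  obtain ⟨e, he⟩ := exists_linearEquiv_comp_eq_of_finrank_ker_eq (toLin' A) (toLin' B)
    fun a k => by rw [hpow, hpow]; exact h a k
  refine ⟨LinearMap.toMatrix' e, ?_, ?_⟩
  · refine IsUnit.of_mul_eq_one (LinearMap.toMatrix' e.symm) ?_
    rw [← LinearMap.toMatrix'_comp]
    simp
  · apply toLin'.injective
    rw [toLin'_mul, toLin'_mul, toLin'_toMatrix']
    exact LinearMap.ext he

theorem exists_real_det_add_smul_ne_zero {A B : Matrix m m ℂ} {z : ℂ} (h : (A + z • B).det ≠ 0) :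
    ∃ t : ℝ, (A + (t : ℂ) • B).det ≠ 0 := by
  let f : Polynomial ℂ := (A.map Polynomial.C + (Polynomial.X : Polynomial ℂ) • B.map Polynomial.C).det
  have hf (w : ℂ) : f.eval w = (A + w • B).det := by
    rw [← Polynomial.coe_evalRingHom, RingHom.map_det]
    congr 1
    ext i j
    simp
    ring
  have hf0 : f ≠ 0 := by
    rintro h0
    rw [← hf, h0, Polynomial.eval_zero] at h
    exact h rfl
  by_contra! hall
  refine hf0 (Polynomial.eq_zero_of_infinite_isRoot f
    ((Set.infinite_range_of_injective Complex.ofReal_injective).mono ?_))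
  rintro _ ⟨t, rfl⟩
  exact (hf t).trans (hall t)

theorem det_quaternionBlocks_unique_nonneg (a : Matrix (Fin 1) (Fin 1) (Quaternion ℝ)) :
    0 ≤ (quaternionBlocks a).det := by
  have h : (quaternionBlocks a).det =
      (Complex.normSq (Quaternion.complexFst (a 0 0)) : ℂ) +
        Complex.normSq (Quaternion.complexSnd (a 0 0)) := by
    rw [← det_reindex_self finSumFinEquiv, det_fin_two, Complex.normSq_eq_conj_mul_self,
      Complex.normSq_eq_conj_mul_self]
    change Quaternion.complexFst (a 0 0) * conj (Quaternion.complexFst (a 0 0)) -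
      Quaternion.complexSnd (a 0 0) * -conj (Quaternion.complexSnd (a 0 0)) = _
    ring
  rw [h, ← Complex.ofReal_add, Complex.zero_le_real]
  exact add_nonneg (Complex.normSq_nonneg _) (Complex.normSq_nonneg _)

theorem det_quaternionBlocks_reindex {n : Type*} [Fintype n] [DecidableEq n] (e : m ≃ n)
    (A : Matrix m m (Quaternion ℝ)) :
    (quaternionBlocks (reindex e e A)).det = (quaternionBlocks A).det := by
  rw [← det_reindex_self (e.sumCongr e) (quaternionBlocks A)]
  congr 1
  ext (i | i) (j | j) <;> rfl

theorem det_quaternionBlocks_fromBlocks {n : Type*} [Fintype n] [DecidableEq n]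
    (A : Matrix m m (Quaternion ℝ)) (B : Matrix m n (Quaternion ℝ)) (C : Matrix n m (Quaternion ℝ))
    (D E : Matrix n n (Quaternion ℝ)) (h1 : D * E = 1) (h2 : E * D = 1) :
    (quaternionBlocks (fromBlocks A B C D)).det =
      (quaternionBlocks D).det * (quaternionBlocks (A - B * E * C)).det := by
  have hr : reindex (Equiv.sumSumSumComm m n m n) (Equiv.sumSumSumComm m n m n)
      (quaternionBlocks (fromBlocks A B C D)) =
      fromBlocks (quaternionBlocks A) (quaternionBlocks B) (quaternionBlocks C)
        (quaternionBlocks D) := by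
    ext ((i | i) | (i | i)) ((j | j) | (j | j)) <;> rfl
  let _ : Invertible (quaternionBlocks D) :=
    ⟨quaternionBlocks E, by rw [← quaternionBlocks_mul, h2, quaternionBlocks_one],
      by rw [← quaternionBlocks_mul, h1, quaternionBlocks_one]⟩
  rw [← det_reindex_self (Equiv.sumSumSumComm m n m n), hr, det_fromBlocks₂₂,
    quaternionBlocks_sub, quaternionBlocks_mul, quaternionBlocks_mul]
  rfl

theorem det_quaternionBlocks_nonneg_of_ne_zero {n : ℕ}
    (ih : ∀ A : Matrix (Fin n) (Fin n) (Quaternion ℝ), 0 ≤ (quaternionBlocks A).det)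
    (A : Matrix (Fin n ⊕ Fin 1) (Fin n ⊕ Fin 1) (Quaternion ℝ))
    (h : A (Sum.inr 0) (Sum.inr 0) ≠ 0) : 0 ≤ (quaternionBlocks A).det := by
  rw [← fromBlocks_toBlocks A, det_quaternionBlocks_fromBlocks _ _ _ _
    (of fun _ _ => (A (Sum.inr 0) (Sum.inr 0))⁻¹)]
  · exact mul_nonneg (det_quaternionBlocks_unique_nonneg _) (ih _)
  · refine Matrix.ext fun i j => ?_
    fin_cases i; fin_cases j
    simp [mul_apply, toBlocks₂₂, h]
  · refine Matrix.ext fun i j => ?_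
    fin_cases i; fin_cases j
    simp [mul_apply, toBlocks₂₂, h]

/-- The quaternionic determinant is a nonnegative real number. -/
theorem det_quaternionBlocks_nonneg {n : ℕ} (A : Matrix (Fin n) (Fin n) (Quaternion ℝ)) :
    0 ≤ (quaternionBlocks A).det := by
  induction n with
  | zero => simp
  | succ n ih =>
    rw [← det_quaternionBlocks_reindex finSumFinEquiv.symm]
    set B := reindex finSumFinEquiv.symm finSumFinEquiv.symm A
    by_cases h : B (Sum.inr 0) (Sum.inr 0) = 0
    · have hlim : Filter.Tendsto (fun t : ℝ => (quaternionBlocks B + (t : ℂ) • 1).det)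
          (nhdsWithin 0 {0}ᶜ) (nhds (quaternionBlocks B).det) := by
        have hc : Continuous fun t : ℝ => (quaternionBlocks B + (t : ℂ) • 1).det := by fun_prop
        have := (hc.tendsto 0).mono_left (nhdsWithin_le_nhds (s := {0}ᶜ))
        simpa using this
      refine ge_of_tendsto hlim (eventually_nhdsWithin_of_forall fun t ht => ?_)
      rw [← quaternionBlocks_one, ← quaternionBlocks_smul, ← quaternionBlocks_add]
      refine det_quaternionBlocks_nonneg_of_ne_zero ih _ ?_
      rw [Matrix.add_apply, h, zero_add, Matrix.smul_apply, one_apply_eq]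
      exact smul_ne_zero ht one_ne_zero
    · exact det_quaternionBlocks_nonneg_of_ne_zero ih B h


/-- Quaternionic matrices that are conjugate over `ℂ` are conjugate by an element of
`SL(n, ℍ)`. -/
theorem exists_det_eq_one_mul_eq_mul {n : ℕ} {A B : Matrix (Fin n) (Fin n) (Quaternion ℝ)}
    (hn : n ≠ 0)
    {P : Matrix (Fin n ⊕ Fin n) (Fin n ⊕ Fin n) ℂ} (hP : IsUnit P)
    (h : P * quaternionBlocks A = quaternionBlocks B * P) :
    ∃ g : Matrix (Fin n) (Fin n) (Quaternion ℝ), (quaternionBlocks g).det = 1 ∧ g * A = B * g := by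
  let J := quaternionJ (Fin n)
  let Q := -(J * (starRingEnd ℂ).mapMatrix P * J)
  have hJJ : J * J = -1 := quaternionJ_mul_self
  have hJJl (Y : Matrix (Fin n ⊕ Fin n) (Fin n ⊕ Fin n) ℂ) : J * (J * Y) = -Y := by
    rw [← mul_assoc, hJJ, neg_one_mul]
  have hJc : (starRingEnd ℂ).mapMatrix J = J := by
    simp only [J, quaternionJ, RingHom.mapMatrix_apply, fromBlocks_map]
    congr 1 <;> ext i j <;> simp [one_apply, apply_ite]
  have hcc (Y : Matrix (Fin n ⊕ Fin n) (Fin n ⊕ Fin n) ℂ) :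
      (starRingEnd ℂ).mapMatrix ((starRingEnd ℂ).mapMatrix Y) = Y := by
    ext i j; simp
  have hI (Y : Matrix (Fin n ⊕ Fin n) (Fin n ⊕ Fin n) ℂ) :
      (starRingEnd ℂ).mapMatrix (Complex.I • Y) = -(Complex.I • (starRingEnd ℂ).mapMatrix Y) := by
    ext i j; simp
  have hPQ : J * (starRingEnd ℂ).mapMatrix P = Q * J := by
    simp only [Q, neg_mul, mul_assoc, hJJ, mul_neg, mul_one, neg_neg]
  have hQP : J * (starRingEnd ℂ).mapMatrix Q = P * J := by
    simp only [Q, map_neg, map_mul, hJc, hcc, mul_neg, mul_assoc, hJJl, neg_neg]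
  have hA := quaternionJ_mul_conj A
  have hB := quaternionJ_mul_conj B
  have hQ : Q * quaternionBlocks A = quaternionBlocks B * Q := by
    have h1 := congrArg (starRingEnd ℂ).mapMatrix h
    rw [map_mul, map_mul] at h1
    calc Q * quaternionBlocks A
        = -(J * (starRingEnd ℂ).mapMatrix P * (J * quaternionBlocks A)) := by
          simp only [Q, neg_mul, mul_assoc]
      _ = -(J * (starRingEnd ℂ).mapMatrix P * ((starRingEnd ℂ).mapMatrix (quaternionBlocks A) * J)) := by
          congr 2
          have := congrArg (starRingEnd ℂ).mapMatrix hA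
          rw [map_mul, map_mul, hcc] at this
          change _ = _ * (starRingEnd ℂ).mapMatrix J at this
          rw [hJc] at this
          rw [← this]
      _ = -(J * ((starRingEnd ℂ).mapMatrix (quaternionBlocks B) * (starRingEnd ℂ).mapMatrix P) * J) := by
          rw [← h1]; simp only [mul_assoc]
      _ = _ := by
          rw [← mul_assoc J, hB]
          simp only [Q, J, mul_neg, mul_assoc]
  obtain ⟨R, hR⟩ := exists_quaternionBlocks_eq (P := P + Q) (by
    rw [map_add, mul_add, add_mul]
    exact (congrArg₂ (· + ·) hPQ hQP).trans (add_comm _ _))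
  obtain ⟨S, hS⟩ := exists_quaternionBlocks_eq (P := Complex.I • (Q - P)) (by
    rw [hI, map_sub, mul_neg, Matrix.mul_smul, mul_sub, Matrix.smul_mul, sub_mul, ← smul_neg, neg_sub]
    exact congrArg (Complex.I • ·) (congrArg₂ (· - ·) hPQ hQP))
  have hRS : (quaternionBlocks R + Complex.I • quaternionBlocks S).det ≠ 0 := by
    have : P + Q + Complex.I • Complex.I • (Q - P) = (2 : ℂ) • P := by
      rw [smul_smul, Complex.I_mul_I]
      module
    rw [hR, hS, this, det_smul]
    exact mul_ne_zero (pow_ne_zero _ two_ne_zero) ((isUnit_iff_isUnit_det P).1 hP).ne_zero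
  obtain ⟨t, ht⟩ := exists_real_det_add_smul_ne_zero hRS
  let g := R + t • S
  have hg : quaternionBlocks g = quaternionBlocks R + (t : ℂ) • quaternionBlocks S := by
    rw [quaternionBlocks_add, quaternionBlocks_smul]
  have hgAB : g * A = B * g := by
    apply quaternionBlocks_injective
    rw [quaternionBlocks_mul, quaternionBlocks_mul, hg, hR, hS]
    simp only [add_mul, mul_add, Matrix.smul_mul, Matrix.mul_smul, sub_mul, mul_sub, h, hQ]
  rw [← hg] at ht
  obtain ⟨d, hd0, hd⟩ : ∃ d : ℝ, 0 ≤ d ∧ (quaternionBlocks g).det = d := by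
    have h0 := Complex.nonneg_iff.1 (det_quaternionBlocks_nonneg g)
    exact ⟨_, h0.1, Complex.ext rfl h0.2.symm⟩
  have hdpos : 0 < d := lt_of_le_of_ne hd0 fun h0 => ht (by rw [hd, ← h0, Complex.ofReal_zero])
  obtain ⟨r, hr⟩ : ∃ r : ℝ, r ^ (n + n) = d⁻¹ :=
    ⟨_, Real.rpow_inv_natCast_pow (inv_nonneg.2 hd0) (by omega)⟩
  refine ⟨r • g, ?_, by rw [Matrix.smul_mul, Matrix.mul_smul, hgAB]⟩
  rw [quaternionBlocks_smul, det_smul, hd, Fintype.card_sum, Fintype.card_fin]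
  norm_cast
  rw [hr, inv_mul_cancel₀ hdpos.ne']

end

/-- an element of sl(n,ℍ) is Ad_{SL(n,ℍ)}-real iff for every λ ∈ ℂ with
nonzero real part and every k, dim ker (Φ(X) - λ·1)^k = dim ker (Φ(X) + λ·1)^k. -/
theorem adSL_real_iff_kernel_dims_quaternion (n : ℕ) (hn : 1 ≤ n)
    (X : Matrix (Fin n) (Fin n) (Quaternion ℝ)) (htr : (Phi X).trace = 0) :
    (∃ g : Matrix (Fin n) (Fin n) (Quaternion ℝ), (Phi g).det = 1 ∧ g * X = -X * g) ↔
      (∀ lam : ℂ, lam.re ≠ 0 → ∀ k : ℕ,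
        kerDim ((Phi X - lam • 1) ^ k) = kerDim ((Phi X + lam • 1) ^ k)) := by
  have hneg (a : ℂ) (k : ℕ) : kerDim ((Phi X + a • 1) ^ k) =
      kerDim ((quaternionBlocks (-X) - a • 1) ^ k) := by
    rw [quaternionBlocks_neg, ← Phi_eq_quaternionBlocks, ← kerDim_neg_pow, neg_add, sub_eq_add_neg]
  constructor
  · rintro ⟨g, hg, hgX⟩ a - k
    rw [hneg]
    have hu : IsUnit (Phi g) := (Matrix.isUnit_iff_isUnit_det _).2 (hg ▸ isUnit_one)
    refine kerDim_eq_of_mul_eq_mul hu (SemiconjBy.pow_right ?_ k)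
    rw [SemiconjBy, mul_sub, sub_mul, Phi_eq_quaternionBlocks, Phi_eq_quaternionBlocks,
      ← quaternionBlocks_mul, ← quaternionBlocks_mul, hgX]
    simp
  · intro h
    obtain ⟨P, hP, hPX⟩ := exists_isUnit_mul_eq_mul_of_kerDim_eq (A := quaternionBlocks X)
        (B := quaternionBlocks (-X)) fun a k => by
      rw [← hneg]
      by_cases ha : a.re = 0
      · have hconj : (starRingEnd ℂ) a = -a := Complex.ext (by simp [ha]) (by simp)
        rw [← kerDim_sub_conj, hconj, neg_smul, sub_neg_eq_add]
        rfl
      · exact h a ha k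
    exact exists_det_eq_one_mul_eq_mul (by omega) hP hPX
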